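/- Let V be a finite-dimensional real vector space equipped with a nondegenerate symmetric bilinear form B, let K ⊆ V be an isotropic subspace, and let L ⊆ V be a lagrangian subspace (L = L⊥). Let q : K⊥ → K⊥/K be the quotient map and let B̄ be the induced nondegenerate symmetric bilinear form on K⊥/K (determined by B̄(q(x), q(y)) = B(x,y) for x, y ∈ K⊥). Then the subspace L_quot := q(L ∩ K⊥) = ((L ∩ K⊥) + K)/K is a lagrangian subspace of (K⊥/K, B̄), i.e. L_quot equals its own B̄-orthogonal. -/

import Mathlib

/-- The `B`-orthogonal of a subspace `S`:
`orthB B S = {v | ∀ s ∈ S, B v s = 0}`. -/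
def orthB {V : Type*} [AddCommGroup V] [Module ℝ V]
    (B : V →ₗ[ℝ] V →ₗ[ℝ] ℝ) (S : Submodule ℝ V) : Submodule ℝ V :=
  ⨅ s ∈ S, LinearMap.ker (B.flip s)

theorem mem_orthB {V : Type*} [AddCommGroup V] [Module ℝ V]
    {B : V →ₗ[ℝ] V →ₗ[ℝ] ℝ} {S : Submodule ℝ V} {v : V} :
    v ∈ orthB B S ↔ ∀ s ∈ S, B v s = 0 := by
  simp [orthB]

theorem orthB_orthB {V : Type*} [AddCommGroup V] [Module ℝ V] [FiniteDimensional ℝ V]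
    {B : V →ₗ[ℝ] V →ₗ[ℝ] ℝ} (hsymm : ∀ x y : V, B x y = B y x)
    (hnd : ∀ x : V, (∀ y : V, B x y = 0) → x = 0) (S : Submodule ℝ V) :
    orthB B (orthB B S) = S := by
  have orthB_eq (T : Submodule ℝ V) : orthB B T = LinearMap.BilinForm.orthogonal B T := by
    ext v
    simp only [mem_orthB, LinearMap.BilinForm.mem_orthogonal_iff, hsymm v]
  have hrefl : B.IsRefl := fun x y h => (hsymm y x).trans h
  have hnondeg : B.Nondegenerate :=
    ⟨hnd, fun x h => hnd x fun y => (hsymm x y).trans (h y)⟩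
  rw [orthB_eq, orthB_eq, LinearMap.BilinForm.orthogonal_orthogonal hnondeg hrefl]

theorem orthB_sup {V : Type*} [AddCommGroup V] [Module ℝ V]
    (B : V →ₗ[ℝ] V →ₗ[ℝ] ℝ) (S T : Submodule ℝ V) :
    orthB B (S ⊔ T) = orthB B S ⊓ orthB B T := by
  ext v
  have h (U : Submodule ℝ V) : v ∈ orthB B U ↔ U ≤ LinearMap.ker (B v) := mem_orthB
  rw [Submodule.mem_inf, h, h, h, sup_le_iff]

theorem stmt11
    {V : Type*} [AddCommGroup V] [Module ℝ V] [FiniteDimensional ℝ V]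
    (B : V →ₗ[ℝ] V →ₗ[ℝ] ℝ)
    (hsymm : ∀ x y : V, B x y = B y x)
    (hnd : ∀ x : V, (∀ y : V, B x y = 0) → x = 0)
    (K : Submodule ℝ V) (hK : K ≤ orthB B K)
    -- L is lagrangian
    (L : Submodule ℝ V) (hL : L = orthB B L)
    -- K viewed as a subspace of K⊥, and the quotient map q = K'.mkQ
    (K' : Submodule ℝ ↥(orthB B K)) (hK' : K' = K.comap (orthB B K).subtype)
    -- the induced nondegenerate symmetric bilinear form on K⊥/K
    (Bbar : (↥(orthB B K) ⧸ K') →ₗ[ℝ] (↥(orthB B K) ⧸ K') →ₗ[ℝ] ℝ)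
    (hBbar : ∀ x y : ↥(orthB B K), Bbar (K'.mkQ x) (K'.mkQ y) = B ↑x ↑y) :
    -- L_quot := q(L ∩ K⊥) is lagrangian in (K⊥/K, Bbar)
    Submodule.map K'.mkQ (L.comap (orthB B K).subtype)
      = orthB Bbar (Submodule.map K'.mkQ (L.comap (orthB B K).subtype)) := by
  have hLK : orthB B (L ⊓ orthB B K) = L ⊔ K := by
    conv_lhs => rw [hL]
    rw [← orthB_sup, orthB_orthB hsymm hnd]
  apply le_antisymm
  · rintro _ ⟨x, hx, rfl⟩
    rw [mem_orthB]
    rintro _ ⟨y, hy, rfl⟩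
    rw [hBbar]
    have hxL : (x : V) ∈ orthB B L := hL ▸ hx
    exact mem_orthB.mp hxL y hy
  · intro v hv
    obtain ⟨x, rfl⟩ := K'.mkQ_surjective v
    have hx : (x : V) ∈ L ⊔ K := by
      rw [← hLK, mem_orthB]
      rintro y ⟨hyL, hyK⟩
      rw [← hBbar x ⟨y, hyK⟩]
      exact mem_orthB.mp hv _ (Submodule.mem_map_of_mem hyL)
    obtain ⟨l, hl, k, hk, hlk⟩ := Submodule.mem_sup.mp hx
    refine ⟨x - ⟨k, hK hk⟩, ?_, ?_⟩
    · simpa [← hlk] using hl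
    · have hk' : K'.mkQ ⟨k, hK hk⟩ = 0 := by
        simpa [hK'] using hk
      rw [map_sub, hk', sub_zero]
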